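/- Suppose S is smooth, let 1 ≤ i ≤ n−p, and let a ∈ ℂ^{(n−p−i+1)×n} be a matrix of maximal rank n−p−i+1. Then (i) W_{K(\underline a)}(S) ∩ S_reg = ⋃_{i ≤ j ≤ n−p} Σ^{(j)}(π_a), and (ii) Δ_i ∩ S_reg = ⋃_{i+1 ≤ j ≤ n−p} Σ^{(j)}(π_a). -/

import Mathlib

open MvPolynomial

noncomputable section

/-- The Zariski closure of a subset of the affine space `σ → ℂ`. -/
def zcl {σ : Type} (T : Set (σ → ℂ)) : Set (σ → ℂ) :=
  MvPolynomial.zeroLocus ℂ (MvPolynomial.vanishingIdeal ℂ T)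

/-- Zariski open subsets of the affine space `σ → ℂ`. -/
def ZOpen {σ : Type} (U : Set (σ → ℂ)) : Prop :=
  ∃ I : Ideal (MvPolynomial σ ℂ), U = {x | ∃ f ∈ I, MvPolynomial.eval x f ≠ 0}

/-- Zariski open subsets of the space of `m × n` complex matrices. -/
def ZOpenMat {m n : ℕ} (U : Set (Matrix (Fin m) (Fin n) ℂ)) : Prop :=
  ∃ I : Ideal (MvPolynomial (Fin m × Fin n) ℂ),
    U = {a | ∃ f ∈ I, MvPolynomial.eval (fun q => a q.1 q.2) f ≠ 0}

/-- `T` is of pure dimension `d`: every irreducible component of (the Zariski closure of) `T`,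
i.e. every minimal prime over its vanishing ideal, has coordinate ring of Krull dimension `d`. -/
def IsPureDim {σ : Type} (T : Set (σ → ℂ)) (d : ℕ) : Prop :=
  ∀ P ∈ (MvPolynomial.vanishingIdeal ℂ T).minimalPrimes,
    ringKrullDim (MvPolynomial σ ℂ ⧸ P) = (d : WithBot (WithTop ℕ))

/-- The Zariski tangent space at a point `x` of (the Zariski closure of) a subset `T`
of affine space: the common kernel of the differentials at `x` of all polynomials
vanishing on `T`. -/
def tangentAt {σ : Type} [Fintype σ] [DecidableEq σ] (T : Set (σ → ℂ)) (x : σ → ℂ) :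
    Submodule ℂ (σ → ℂ) :=
  ⨅ (f : MvPolynomial σ ℂ) (_ : f ∈ MvPolynomial.vanishingIdeal ℂ T),
    LinearMap.ker
      (∑ l, MvPolynomial.eval x (MvPolynomial.pderiv l f) •
        (LinearMap.proj l : (σ → ℂ) →ₗ[ℂ] ℂ))

/-- `rs` is a regular sequence in the commutative ring `R`. -/
def IsRegSeq {R : Type*} [CommRing R] (rs : List R) : Prop :=
  Ideal.span {x | x ∈ rs} ≠ ⊤ ∧
  ∀ j, j < rs.length → ∀ b : R,
    rs.getD j 0 * b ∈ Ideal.span {x | x ∈ rs.take j} →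
    b ∈ Ideal.span {x | x ∈ rs.take j}

/-- The common zero set in `ℂⁿ` of polynomials `F₁, …, F_p ∈ ℚ[X₁, …, Xₙ]`. -/
def zeroSetC {n p : ℕ} (F : Fin p → MvPolynomial (Fin n) ℚ) : Set (Fin n → ℂ) :=
  {x | ∀ k, MvPolynomial.aeval x (F k) = 0}

/-- The Jacobian matrix `[∂F_k/∂X_l]` evaluated at `x ∈ ℂⁿ`. -/
def jacC {n p : ℕ} (F : Fin p → MvPolynomial (Fin n) ℚ) (x : Fin n → ℂ) :
    Matrix (Fin p) (Fin n) ℂ :=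
  Matrix.of fun k l => MvPolynomial.aeval x (MvPolynomial.pderiv l (F k))

/-- The set of regular points of `S = {F₁ = 0, …, F_p = 0}`: points of `S` where the
Jacobian has maximal rank `p`. -/
def SregC {n p : ℕ} (F : Fin p → MvPolynomial (Fin n) ℚ) : Set (Fin n → ℂ) :=
  {x | x ∈ zeroSetC F ∧ (jacC F x).rank = p}

/-- The classic polar variety: the Zariski closure of the locus of regular points of `S`
where the matrix obtained by appending the rows of `a` to the Jacobian has rank at
most `r` (i.e. where all `(r+1)`-minors vanish). -/
def Wclassic {n p m : ℕ} (F : Fin p → MvPolynomial (Fin n) ℚ)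
    (a : Matrix (Fin m) (Fin n) ℂ) (r : ℕ) : Set (Fin n → ℂ) :=
  zcl {x | x ∈ SregC F ∧ (Matrix.fromRows (jacC F x) a).rank ≤ r}

/-- The dual polar variety: as `Wclassic`, with appended rows `(a_{k,1} - X₁, …, a_{k,n} - Xₙ)`. -/
def Wdual {n p m : ℕ} (F : Fin p → MvPolynomial (Fin n) ℚ)
    (a : Matrix (Fin m) (Fin n) ℂ) (r : ℕ) : Set (Fin n → ℂ) :=
  zcl {x | x ∈ SregC F ∧
    (Matrix.fromRows (jacC F x) (Matrix.of fun k l => a k l - x l)).rank ≤ r}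

/-- `F₁, …, F_p` generate the full vanishing ideal of their zero set (over `ℂ`);
this encodes that `(F₁, …, F_p)` is reduced (radical) and the ideal of definition of `S`. -/
def idealOfDef {n p : ℕ} (F : Fin p → MvPolynomial (Fin n) ℚ) : Prop :=
  MvPolynomial.vanishingIdeal ℂ (zeroSetC F) =
    Ideal.span (Set.range fun k => MvPolynomial.map (algebraMap ℚ ℂ) (F k))

/-- The submatrix of the first `m` rows of a matrix. -/
def firstRows {N n' m : ℕ} (a : Matrix (Fin N) (Fin n') ℂ) (h : m ≤ N) :
    Matrix (Fin m) (Fin n') ℂ :=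
  Matrix.of fun k l => a (Fin.castLE h k) l

/-- The matrix obtained by deleting row `h`. -/
def rowErase {m n' : ℕ} (a : Matrix (Fin (m + 1)) (Fin n') ℂ) (h : Fin (m + 1)) :
    Matrix (Fin m) (Fin n') ℂ :=
  Matrix.of fun k l => a (h.succAbove k) l

/-- The real trace `S_ℝ := S ∩ ℝⁿ`, as a subset of Euclidean space. -/
def SR {n p : ℕ} (F : Fin p → MvPolynomial (Fin n) ℚ) : Set (EuclideanSpace ℝ (Fin n)) :=
  {x | (fun j => (x j : ℂ)) ∈ zeroSetC F}

/-- `C` is a connected component of `T`. -/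
def IsConnCompOf {α : Type*} [TopologicalSpace α] (C T : Set α) : Prop :=
  C.Nonempty ∧ C ⊆ T ∧ IsPreconnected C ∧
    ∀ D, C ⊆ D → D ⊆ T → IsPreconnected D → D = C

end

/-- The Thom–Boardman stratum \`Σ^{(j)}(π_a)\`: the set of regular points of \`S\` at which
the kernel of the differential of \`π_a\` (the linear map induced by \`a\`) restricted to the
Zariski tangent space of \`S\` has dimension \`j\`. -/
noncomputable def SigmaStr {n p m : ℕ} (F : Fin p → MvPolynomial (Fin n) ℚ)
    (a : Matrix (Fin m) (Fin n) ℂ) (j : ℕ) : Set (Fin n → ℂ) :=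
  {x | x ∈ SregC F ∧
    Module.finrank ℂ
      ↥(tangentAt (zeroSetC F) x ⊓ LinearMap.ker (Matrix.mulVecLin a)) = j}

theorem Matrix.exists_mul_mul_eq_one_of_le_rank {K m n : Type*} [Field K] [Fintype m]
    [DecidableEq m] [Fintype n] (M : Matrix m n K) {r : ℕ} (h : r ≤ M.rank) :
    ∃ (A : Matrix (Fin r) m K) (B : Matrix n (Fin r) K), A * M * B = 1 := by
  obtain ⟨w, hw⟩ := exists_linearIndependent_of_le_finrank
    (R := K) (M := LinearMap.range M.mulVecLin) h
  choose v hv using fun i => (w i).2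
  have hw' : LinearIndependent K fun i => (w i : m → K) :=
    hw.map' (Submodule.subtype _) (Submodule.ker_subtype _)
  have hcol : (M * (Matrix.of v).transpose).col = fun i => (w i : m → K) := by
    funext i
    rw [← hv i]
    rfl
  have hinj : Function.Injective (M * (Matrix.of v).transpose).mulVecLin := by
    have := Matrix.mulVec_injective_iff.2 (hcol ▸ hw')
    exact this
  obtain ⟨g, hg⟩ := LinearMap.exists_leftInverse_of_injective _ (LinearMap.ker_eq_bot.2 hinj)
  refine ⟨LinearMap.toMatrix' g, (Matrix.of v).transpose, ?_⟩
  have := congrArg LinearMap.toMatrix' hg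
  rw [LinearMap.toMatrix'_comp, LinearMap.toMatrix'_id] at this
  rw [Matrix.mul_assoc, ← this, ← Matrix.toLin'_apply', LinearMap.toMatrix'_toLin']

theorem rank_le_of_mem_zcl {σ m n : Type} [Fintype m] [Fintype n]
    (M : Matrix m n (MvPolynomial σ ℂ)) {r : ℕ} {T : Set (σ → ℂ)}
    (hT : ∀ y ∈ T, (M.map (MvPolynomial.eval y)).rank ≤ r) {x : σ → ℂ} (hx : x ∈ zcl T) :
    (M.map (MvPolynomial.eval x)).rank ≤ r := by
  classical
  by_contra! hlt
  obtain ⟨A, B, hAB⟩ := Matrix.exists_mul_mul_eq_one_of_le_rank _ (Nat.succ_le_of_lt hlt)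
  let A' : Matrix (Fin (r + 1)) m (MvPolynomial σ ℂ) := A.map C
  let B' : Matrix n (Fin (r + 1)) (MvPolynomial σ ℂ) := B.map C
  have heval : ∀ y : σ → ℂ,
      MvPolynomial.aeval y (Matrix.det (n := Fin (r + 1)) (A' * M * B')) =
        Matrix.det (n := Fin (r + 1)) (A * M.map (MvPolynomial.eval y) * B) := by
    intro y
    have hC : ∀ {k l : Type} (N : Matrix k l ℂ),
        (N.map (C : ℂ → MvPolynomial σ ℂ)).map (MvPolynomial.eval y) = N := by
      intro k l N
      ext
      simp
    rw [MvPolynomial.aeval_eq_eval, RingHom.map_det, RingHom.mapMatrix_apply,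
      Matrix.map_mul, Matrix.map_mul, hC, hC]
  have h0 := (MvPolynomial.mem_zeroLocus_iff.1 hx)
    (Matrix.det (n := Fin (r + 1)) (A' * M * B')) (by
      rw [MvPolynomial.mem_vanishingIdeal_iff]
      intro y hy
      rw [heval]
      by_contra hne
      have h1 := Matrix.rank_of_det_ne_zero hne
      have h2 := (Matrix.rank_mul_le_left (A * M.map (MvPolynomial.eval y)) B).trans
        ((Matrix.rank_mul_le_right A _).trans (hT y hy))
      rw [h1, Fintype.card_fin] at h2
      omega)
  rw [heval, hAB, Matrix.det_one] at h0
  exact one_ne_zero h0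

theorem subset_zcl {σ : Type} (T : Set (σ → ℂ)) : T ⊆ zcl T :=
  MvPolynomial.zeroLocus_vanishingIdeal_le T

theorem Matrix.finrank_ker_mulVecLin {K m n : Type*} [Field K] [Fintype n] (M : Matrix m n K) :
    M.rank + Module.finrank K (LinearMap.ker M.mulVecLin) = Fintype.card n := by
  simpa [Matrix.rank] using M.mulVecLin.finrank_range_add_finrank_ker

theorem Matrix.ker_mulVecLin_fromRows {K m₁ m₂ n : Type*} [CommSemiring K] [Fintype n]
    (M : Matrix m₁ n K) (N : Matrix m₂ n K) :
    LinearMap.ker (Matrix.fromRows M N).mulVecLin =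
      LinearMap.ker M.mulVecLin ⊓ LinearMap.ker N.mulVecLin := by
  ext v
  simp only [LinearMap.mem_ker, Submodule.mem_inf, Matrix.mulVecLin_apply,
    Matrix.fromRows_mulVec]
  constructor
  · intro h
    exact ⟨funext fun i => congrFun h (Sum.inl i), funext fun i => congrFun h (Sum.inr i)⟩
  · rintro ⟨h₁, h₂⟩
    rw [h₁, h₂]
    ext (i | i) <;> rfl

theorem mem_tangentAt {σ : Type} [Fintype σ] [DecidableEq σ] {T : Set (σ → ℂ)} {x v : σ → ℂ} :
    v ∈ tangentAt T x ↔ ∀ f ∈ MvPolynomial.vanishingIdeal ℂ T,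
      ∑ l, MvPolynomial.eval x (MvPolynomial.pderiv l f) * v l = 0 := by
  simp [tangentAt, Submodule.mem_iInf]

theorem tangentAt_zeroSetC {n p : ℕ} {F : Fin p → MvPolynomial (Fin n) ℚ}
    (hrad : idealOfDef F) {x : Fin n → ℂ} (hx : x ∈ zeroSetC F) :
    tangentAt (zeroSetC F) x = LinearMap.ker (jacC F x).mulVecLin := by
  have hJ : ∀ (v : Fin n → ℂ) k, ((jacC F x).mulVec v) k = ∑ l, MvPolynomial.eval x
      (MvPolynomial.pderiv l (MvPolynomial.map (algebraMap ℚ ℂ) (F k))) * v l := by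
    intro v k
    simp [jacC, Matrix.mulVec, dotProduct, MvPolynomial.pderiv_map, MvPolynomial.eval_map,
      MvPolynomial.aeval_def]
  ext v
  rw [mem_tangentAt, LinearMap.mem_ker, Matrix.mulVecLin_apply]
  constructor
  · intro h
    funext k
    rw [hJ]
    exact h _ (hrad ▸ Ideal.subset_span ⟨k, rfl⟩)
  · intro h f hf
    have hf' := hf
    rw [hrad] at hf'
    induction hf' using Submodule.span_induction with
    | mem f hmem =>
      obtain ⟨k, rfl⟩ := hmem
      rw [← hJ, h, Pi.zero_apply]
    | zero => simp
    | add f g hf₁ hg₁ ihf ihg =>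
      have hf₁ := hrad.ge hf₁
      have hg₁ := hrad.ge hg₁
      simp [add_mul, Finset.sum_add_distrib, ihf hf₁, ihg hg₁]
    | smul c f hf₁ ihf =>
      have hf₁ := hrad.ge hf₁
      have hfx : MvPolynomial.eval x f = 0 := by
        simpa [MvPolynomial.aeval_eq_eval] using MvPolynomial.mem_vanishingIdeal_iff.1 hf₁ x hx
      simp only [smul_eq_mul, Derivation.leibniz, map_add, map_mul, hfx, zero_mul, add_zero,
        mul_assoc, ← Finset.mul_sum, ihf hf₁, mul_zero]

theorem rank_fromRows_add_finrank_tangentAt {n p m : ℕ} {F : Fin p → MvPolynomial (Fin n) ℚ}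
    (hrad : idealOfDef F) (a : Matrix (Fin m) (Fin n) ℂ) {x : Fin n → ℂ}
    (hx : x ∈ zeroSetC F) :
    (Matrix.fromRows (jacC F x) a).rank + Module.finrank ℂ
      ↥(tangentAt (zeroSetC F) x ⊓ LinearMap.ker (Matrix.mulVecLin a)) = n := by
  rw [tangentAt_zeroSetC hrad hx, ← Matrix.ker_mulVecLin_fromRows,
    Matrix.finrank_ker_mulVecLin, Fintype.card_fin]

theorem finrank_tangentAt_inf_le {n p m : ℕ} {F : Fin p → MvPolynomial (Fin n) ℚ}
    (hrad : idealOfDef F) (a : Matrix (Fin m) (Fin n) ℂ) {x : Fin n → ℂ}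
    (hx : x ∈ SregC F) :
    Module.finrank ℂ ↥(tangentAt (zeroSetC F) x ⊓ LinearMap.ker (Matrix.mulVecLin a))
      ≤ n - p := by
  have h := Matrix.finrank_ker_mulVecLin (jacC F x)
  rw [← tangentAt_zeroSetC hrad hx.1, hx.2, Fintype.card_fin] at h
  exact (Submodule.finrank_mono inf_le_left).trans (by omega)

theorem mem_iUnion_SigmaStr {n p m i : ℕ} {F : Fin p → MvPolynomial (Fin n) ℚ}
    (hrad : idealOfDef F) (a : Matrix (Fin m) (Fin n) ℂ) (hi : i ≤ n) {x : Fin n → ℂ} :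
    x ∈ ⋃ j ∈ Set.Icc i (n - p), SigmaStr F a j ↔
      x ∈ SregC F ∧ (Matrix.fromRows (jacC F x) a).rank ≤ n - i := by
  simp only [Set.mem_iUnion, SigmaStr, Set.mem_ofPred_eq, Set.mem_Icc, exists_prop]
  constructor
  · rintro ⟨j, ⟨hj, -⟩, hx, hfin⟩
    have := rank_fromRows_add_finrank_tangentAt hrad a hx.1
    exact ⟨hx, by omega⟩
  · rintro ⟨hx, hr⟩
    have := rank_fromRows_add_finrank_tangentAt hrad a hx.1
    exact ⟨_, ⟨by omega, finrank_tangentAt_inf_le hrad a hx⟩, hx, rfl⟩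

theorem rank_le_of_mem_Wclassic {n p m r : ℕ} {F : Fin p → MvPolynomial (Fin n) ℚ}
    {a : Matrix (Fin m) (Fin n) ℂ} {x : Fin n → ℂ} (hx : x ∈ Wclassic F a r) :
    (Matrix.fromRows (jacC F x) a).rank ≤ r := by
  have hM : ∀ y : Fin n → ℂ, (Matrix.fromRows
      (Matrix.of fun k l => MvPolynomial.map (algebraMap ℚ ℂ) (MvPolynomial.pderiv l (F k)))
      (a.map C)).map (MvPolynomial.eval y) = Matrix.fromRows (jacC F y) a := by
    intro y
    ext (k | k) l
    · simp [jacC, MvPolynomial.eval_map, MvPolynomial.aeval_def]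
    · simp
  rw [← hM]
  exact rank_le_of_mem_zcl _ (fun y hy => hM y ▸ hy.2) hx

/-- Lemma 3 of the paper. Suppose `S` is smooth, `1 ≤ i ≤ n-p`, and
let `a` be an `(n-p-i+1) × n` matrix of maximal rank. Then
(i) `W_{K(a)}(S) ∩ S_reg = ⋃_{i ≤ j ≤ n-p} Σ^{(j)}(π_a)` and
(ii) `Δ_i ∩ S_reg = ⋃_{i+1 ≤ j ≤ n-p} Σ^{(j)}(π_a)`. -/
theorem statement12 {n p i : ℕ} (hp1 : 1 ≤ p) (hpn : p ≤ n)
    (hi1 : 1 ≤ i) (hi2 : i ≤ n - p)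
    (F : Fin p → MvPolynomial (Fin n) ℚ)
    (hreg : IsRegSeq (List.ofFn F))
    (hrad : idealOfDef F)
    (hSne : (zeroSetC F).Nonempty)
    (hSdim : IsPureDim (zeroSetC F) (n - p))
    (hsmooth : SregC F = zeroSetC F)
    (a : Matrix (Fin (n - p - i + 1)) (Fin n) ℂ)
    (ha : a.rank = n - p - i + 1) :
    (Wclassic F a (n - i) ∩ SregC F =
      ⋃ j ∈ Set.Icc i (n - p), SigmaStr F a j) ∧
    ({x | x ∈ zeroSetC F ∧ (Matrix.fromRows (jacC F x) a).rank ≤ n - i - 1} ∩ SregC F =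
      ⋃ j ∈ Set.Icc (i + 1) (n - p), SigmaStr F a j) := by
  refine ⟨Set.ext fun x => ?_, Set.ext fun x => ?_⟩
  · rw [mem_iUnion_SigmaStr hrad a (by omega)]
    exact ⟨fun h => ⟨h.2, rank_le_of_mem_Wclassic h.1⟩, fun h => ⟨subset_zcl _ h, h.1⟩⟩
  · rw [mem_iUnion_SigmaStr hrad a (by omega), Nat.sub_add_eq]
    exact ⟨fun h => ⟨h.2, h.1.2⟩, fun h => ⟨⟨h.1.1, h.2⟩, h.1⟩⟩
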